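/- In the W(n)_μ-module T_μ(0,1), the subspace T′_μ(0,1) spanned by {v_β : β ∈ ℤⁿ, β ≠ 0} is a W(n)_μ-submodule of codimension 1, it is irreducible, and it is isomorphic as a W(n)_μ-module to the quotient T̄_μ(0,0) := T_μ(0,0)/ℂv_0. -/

import Mathlib

/-- The index lattice `ℤⁿ` (as functions `Fin n → ℤ`). -/
abbrev Zn (n : ℕ) := Fin n → ℤ

/-- Underlying vector space of the solenoidal Witt algebra `W(n)_μ`:
finitely supported functions `ℤⁿ → ℂ`, with basis `e_α = single α 1`. -/
abbrev Wn (n : ℕ) := Zn n →₀ ℂ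

/-- `μ·α = μ₁α₁ + ⋯ + μₙαₙ`. -/
noncomputable def mdot {n : ℕ} (μ : Fin n → ℂ) (α : Zn n) : ℂ :=
  ∑ i, μ i * (α i : ℂ)

/-- `μ` is generic: `μ·α ≠ 0` for every nonzero `α ∈ ℤⁿ`. -/
def Generic {n : ℕ} (μ : Fin n → ℂ) : Prop :=
  ∀ α : Zn n, α ≠ 0 → mdot μ α ≠ 0

/-- The basis vector `e_α` of `W(n)_μ`. -/
noncomputable def ew {n : ℕ} (α : Zn n) : Wn n := Finsupp.single α 1

/-- Underlying space of the tensor-field modules `T_μ(a,b)`: the free `ℂ`-module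
with basis `{v_β : β ∈ ℤⁿ}`. -/
abbrev Tn (n : ℕ) := Zn n →₀ ℂ

/-- The basis vector `v_β` of `T_μ(a,b)`. -/
noncomputable def vv {n : ℕ} (β : Zn n) : Tn n := Finsupp.single β 1

theorem mdot_zero {n : ℕ} (μ : Fin n → ℂ) : mdot μ 0 = 0 := by
  simp [mdot]

theorem mdot_add {n : ℕ} (μ : Fin n → ℂ) (α β : Zn n) :
    mdot μ (α + β) = mdot μ α + mdot μ β := by
  simp [mdot, mul_add, Finset.sum_add_distrib]

theorem Generic.mdot_injective {n : ℕ} {μ : Fin n → ℂ} (hμ : Generic μ) :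
    Function.Injective (mdot μ) := by
  intro α β h
  by_contra hne
  apply hμ (α - β) (sub_ne_zero.mpr hne)
  have := mdot_add μ (α - β) β
  rw [sub_add_cancel, h] at this
  simpa using this.symm

/-- The span of the basis vectors `v_β` with `β ≠ 0` is the kernel of the coordinate at `0`. -/
theorem span_vv_ne_zero_eq_ker (n : ℕ) :
    Submodule.span ℂ {x : Tn n | ∃ β : Zn n, β ≠ 0 ∧ x = vv β} =
      LinearMap.ker (Finsupp.lapply (R := ℂ) (M := ℂ) (0 : Zn n)) := by
  apply le_antisymm
  · rw [Submodule.span_le]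
    rintro _ ⟨β, hβ, rfl⟩
    simp [vv, hβ]
  · intro w hw
    have hw0 : w 0 = 0 := hw
    rw [← Finsupp.sum_single w]
    refine Submodule.sum_mem _ fun β hβ => ?_
    have hβ0 : β ≠ 0 := by
      rintro rfl
      exact Finsupp.mem_support_iff.mp hβ hw0
    have : Finsupp.single β (w β) = w β • vv (n := n) β := by simp [vv]
    rw [this]
    exact Submodule.smul_mem _ _ (Submodule.subset_span ⟨β, hβ0, rfl⟩)

/-- A nonzero subspace stable under a diagonal operator with pairwise distinct eigenvalues
contains a basis vector from the support of any of its nonzero elements. -/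
theorem exists_single_mem_of_diagonal {ι K : Type*} [Field K] {c : ι → K}
    (hc : Function.Injective c) (D : (ι →₀ K) →ₗ[K] (ι →₀ K))
    (hD : ∀ w i, D w i = c i * w i) (U : Submodule K (ι →₀ K))
    (hU : ∀ w ∈ U, D w ∈ U) {w : ι →₀ K} (hw : w ∈ U) (hw0 : w ≠ 0) :
    ∃ i, Finsupp.single i (1 : K) ∈ U := by
  induction hk : w.support.card using Nat.strong_induction_on generalizing w with
  | _ k ih =>
    obtain ⟨i, hi⟩ := Finsupp.support_nonempty_iff.mpr hw0
    have hwi := Finsupp.mem_support_iff.mp hi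
    have hmem : D w - c i • w ∈ U := U.sub_mem (hU w hw) (U.smul_mem _ hw)
    have hval : ∀ j, (D w - c i • w) j = (c j - c i) * w j := by
      intro j
      simp [hD, sub_mul]
    by_cases hz : D w - c i • w = 0
    · refine ⟨i, ?_⟩
      have hsingle : Finsupp.single i 1 = (w i)⁻¹ • w := by
        ext j
        by_cases hj : j = i
        · subst hj
          simp [hwi]
        · have h := hval j
          rw [hz, Finsupp.zero_apply, eq_comm, mul_eq_zero, sub_eq_zero] at h
          rcases h with h | h
          · exact absurd (hc h) hj
          · simp [h, Ne.symm hj]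
      rw [hsingle]
      exact U.smul_mem _ hw
    · refine ih _ ?_ hmem hz rfl
      rw [← hk]
      apply Finset.card_lt_card
      rw [Finset.ssubset_iff_of_subset]
      · exact ⟨i, hi, by simp [hD]⟩
      · intro j hj
        rw [Finsupp.mem_support_iff, hval] at hj
        exact Finsupp.mem_support_iff.mpr (right_ne_zero_of_mul hj)

/-- The first isomorphism theorem for a quotient by a submodule equal to the kernel. -/
theorem exists_quot_equiv_of_eq_ker {R M N : Type*} [Ring R] [AddCommGroup M] [AddCommGroup N]
    [Module R M] [Module R N] (f : M →ₗ[R] N) (hf : Function.Surjective f)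
    {L : Submodule R M} (hL : L = LinearMap.ker f) :
    ∃ ψ : (M ⧸ L) ≃ₗ[R] N, ∀ u, ψ (L.mkQ u) = f u := by
  subst hL
  exact ⟨f.quotKerEquivOfSurjective hf, f.quotKerEquivOfSurjective_apply_mk hf⟩

/-- In the `W(n)_μ`-module `T_μ(0,1)` (action `ρ₁`), the subspace
`T′_μ(0,1) = span{v_β : β ≠ 0}` is a submodule of codimension 1, it is irreducible,
and it is isomorphic as a `W(n)_μ`-module to the quotient `T̄_μ(0,0) = T_μ(0,0)/ℂv_0`,
where `ρQ` is the action induced by `ρ₀` (the action of `T_μ(0,0)`) on the quotient. -/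
theorem stmt10 (n : ℕ) (hn : 1 ≤ n) (μ : Fin n → ℂ) (hμ : Generic μ)
    (ρ₀ ρ₁ : Wn n →ₗ[ℂ] Tn n →ₗ[ℂ] Tn n)
    (hρ₀ : ∀ α β : Zn n, ρ₀ (ew α) (vv β) = (mdot μ β) • vv (α + β))
    (hρ₁ : ∀ α β : Zn n, ρ₁ (ew α) (vv β) = (mdot μ β + mdot μ α) • vv (α + β))
    (T' : Submodule ℂ (Tn n))
    (hT' : T' = Submodule.span ℂ {x : Tn n | ∃ β : Zn n, β ≠ 0 ∧ x = vv β})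
    (L : Submodule ℂ (Tn n)) (hL : L = Submodule.span ℂ {vv (0 : Zn n)})
    (ρQ : Wn n →ₗ[ℂ] (Tn n ⧸ L) →ₗ[ℂ] (Tn n ⧸ L))
    (hρQ : ∀ (x : Wn n) (w : Tn n), ρQ x (L.mkQ w) = L.mkQ (ρ₀ x w)) :
    (∀ (x : Wn n), ∀ w ∈ T', ρ₁ x w ∈ T') ∧
    Module.finrank ℂ (Tn n ⧸ T') = 1 ∧
    (∀ U : Submodule ℂ (Tn n), (∀ (x : Wn n), ∀ w ∈ U, ρ₁ x w ∈ U) →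
      U ≤ T' → U = ⊥ ∨ U = T') ∧
    (∃ φ : T' ≃ₗ[ℂ] (Tn n ⧸ L),
      ∀ (x : Wn n) (w : T') (hw : ρ₁ x (w : Tn n) ∈ T'),
        φ ⟨ρ₁ x (w : Tn n), hw⟩ = ρQ x (φ w)) := by
  have hρ₁_coord : ∀ x w, ρ₁ x w ∈ T' := by
    intro x w
    rw [hT', span_vv_ne_zero_eq_ker, LinearMap.mem_ker]
    have h : ρ₁.compr₂ (Finsupp.lapply (R := ℂ) (M := ℂ) (0 : Zn n)) = 0 := by
      ext α β
      have h := hρ₁ α β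
      rw [add_comm (mdot μ β), ← mdot_add] at h
      simp only [ew, vv] at h
      by_cases hαβ : α + β = 0
      · simp [h, hαβ, mdot_zero]
      · simp [h, hαβ]
    exact LinearMap.congr_fun₂ h x w
  have hD : ∀ (w : Tn n) (γ : Zn n), ρ₁ (ew 0) w γ = mdot μ γ * w γ := by
    intro w γ
    have h : Finsupp.lapply (R := ℂ) (M := ℂ) γ ∘ₗ ρ₁ (ew 0) =
        mdot μ γ • Finsupp.lapply γ := by
      ext β
      have h := hρ₁ 0 β
      simp only [vv, mdot_zero, add_zero, zero_add] at h
      by_cases hβ : β = γ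
      · subst hβ
        simp [h]
      · simp [h, hβ]
    exact LinearMap.congr_fun h w
  have hcomm : ∀ x w, ρ₁ (ew 0) (ρ₀ x w) = ρ₁ x (ρ₁ (ew 0) w) := by
    have h : ρ₀.compr₂ (ρ₁ (ew 0)) = ρ₁.compl₂ (ρ₁ (ew 0)) := by
      ext α β : 4
      have h₀ := hρ₀ α β
      have h₁ := hρ₁ α β
      have h₂ := hρ₁ 0 β
      have h₃ := hρ₁ 0 (α + β)
      simp only [mdot_zero, add_zero, zero_add] at h₂ h₃
      change ρ₁ (ew 0) (ρ₀ (ew α) (vv β)) = ρ₁ (ew α) (ρ₁ (ew 0) (vv β))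
      rw [h₀, h₂, map_smul, map_smul, h₁, h₃, mdot_add, add_comm (mdot μ α)]
    exact LinearMap.congr_fun₂ h
  refine ⟨fun x w _ => hρ₁_coord x w, ?_, ?_, ?_⟩
  · rw [hT', span_vv_ne_zero_eq_ker]
    have hsurj : Function.Surjective (Finsupp.lapply (R := ℂ) (M := ℂ) (0 : Zn n)) :=
      fun c => ⟨Finsupp.single 0 c, by simp⟩
    rw [(LinearMap.quotKerEquivOfSurjective _ hsurj).finrank_eq, Module.finrank_self]
  · intro U hU hUT
    refine or_iff_not_imp_left.mpr fun hne => le_antisymm hUT ?_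
    obtain ⟨w, hw, hw0⟩ := U.ne_bot_iff.mp hne
    obtain ⟨β, hβ⟩ := exists_single_mem_of_diagonal hμ.mdot_injective (ρ₁ (ew 0)) hD U
      (hU _) hw hw0
    rw [hT', Submodule.span_le]
    rintro _ ⟨γ, hγ, rfl⟩
    have h := hU (ew (γ - β)) _ hβ
    have h' := hρ₁ (γ - β) β
    rw [add_comm (mdot μ β), ← mdot_add, sub_add_cancel] at h'
    change ρ₁ (ew (γ - β)) (vv β) ∈ U at h
    rw [h'] at h
    exact (U.smul_mem_iff (hμ γ hγ)).mp h
  · let D : Tn n →ₗ[ℂ] T' := (ρ₁ (ew 0)).codRestrict T' (hρ₁_coord _)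
    have hsurj : Function.Surjective D := by
      have hle : T' ≤ LinearMap.range (ρ₁ (ew 0)) := by
        rw [hT', Submodule.span_le]
        rintro _ ⟨β, hβ, rfl⟩
        refine ⟨(mdot μ β)⁻¹ • vv β, ?_⟩
        rw [map_smul, hρ₁, mdot_zero, add_zero, zero_add, inv_smul_smul₀ (hμ β hβ)]
      rintro ⟨w, hw⟩
      obtain ⟨u, hu⟩ := hle hw
      exact ⟨u, Subtype.ext hu⟩
    have hker : L = LinearMap.ker D := by
      rw [LinearMap.ker_codRestrict, hL]
      apply le_antisymm
      · rw [Submodule.span_singleton_le_iff_mem, LinearMap.mem_ker, hρ₁]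
        simp [mdot_zero]
      · intro u hu
        rw [Submodule.mem_span_singleton]
        refine ⟨u 0, ?_⟩
        ext γ
        by_cases hγ : γ = 0
        · simp [vv, hγ]
        · have h := hD u γ
          rw [LinearMap.mem_ker.mp hu, Finsupp.zero_apply, eq_comm, mul_eq_zero] at h
          simp [vv, Ne.symm hγ, h.resolve_left (hμ γ hγ)]
    obtain ⟨ψ, hψ⟩ := exists_quot_equiv_of_eq_ker (R := ℂ) (M := Tn n) (N := T') D hsurj hker
    refine ⟨ψ.symm, fun x w hw => ?_⟩
    obtain ⟨u, rfl⟩ := hsurj w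
    have hu : ψ.symm (D u) = L.mkQ u := (LinearEquiv.symm_apply_eq ψ).mpr (hψ u).symm
    rw [hu, hρQ, LinearEquiv.symm_apply_eq, hψ]
    exact Subtype.ext (hcomm x u).symm
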